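/- Let G be a spider with body v, and let I and J be independent sets of G with |I| = |J| such that I ↭ J, no token of I is (G,I)-rigid, and no token of J is (G,J)-rigid. Suppose that |I_L| = |J_L| for every leg L of G. Then there exists a TS-sequence between I and J of length exactly M*(G,I,J); in particular D*(G,I,J) = 0. -/

import Mathlib

/-!
Common definitions for formalizing "Shortest Reconfiguration Sequence for
Sliding Tokens on Spiders" (Hoang, Khorramian, Uehara).
-/

namespace SlidingTokenPaper

variable {V : Type*} [Fintype V] [DecidableEq V]

/-- A finite vertex set is independent in `G`. -/
def IsIndep (G : SimpleGraph V) (I : Finset V) : Prop :=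
  ∀ x ∈ I, ∀ y ∈ I, ¬ G.Adj x y

/-- One token slide: a token moves from `x` to `y` along an edge `xy`. -/
def Step (G : SimpleGraph V) (A B : Finset V) : Prop :=
  ∃ x y : V, G.Adj x y ∧ A \ B = {x} ∧ B \ A = {y}

/-- `S` is a TS-sequence between the independent sets `I` and `J` of `G`. -/
def IsTSSeq (G : SimpleGraph V) (I J : Finset V) (S : List (Finset V)) : Prop :=
  S ≠ [] ∧ S.head? = some I ∧ S.getLast? = some J ∧
  (∀ A ∈ S, IsIndep G A ∧ A.card = I.card) ∧ List.Chain' (Step G) S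

/-- The length of a TS-sequence: number of token slides. -/
def len (S : List (Finset V)) : ℕ := S.length - 1

/-- `I ↭ J`: there is a TS-sequence between `I` and `J`. -/
def Reconf (G : SimpleGraph V) (I J : Finset V) : Prop :=
  ∃ S, IsTSSeq G I J S

/-- `M*(G,I,J)`: the minimum over all bijections (target assignments)
`f : I → J` of `∑_{w ∈ I} dist_G(w, f(w))`. -/
noncomputable def Mstar (G : SimpleGraph V) (I J : Finset V) : ℕ :=
  sInf { m : ℕ | ∃ e : {x // x ∈ I} ≃ {y // y ∈ J},
    m = ∑ x : {x // x ∈ I}, G.dist (x : V) ((e x : V)) }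

/-- The number of occurrences of the move `x → y` in `S`. -/
def moveCount (S : List (Finset V)) (x y : V) : ℕ :=
  ((S.zip S.tail).filter fun p => p.1 \ p.2 = {x} ∧ p.2 \ p.1 = {y}).length

/-- `D_G(S, e)`: twice the minimum of the numbers of occurrences of the moves
`x → y` and `y → x` in `S`, where `e = xy`. -/
def detours (S : List (Finset V)) : Sym2 V → ℕ :=
  Sym2.lift ⟨fun x y => 2 * min (moveCount S x y) (moveCount S y x),
    fun x y => by dsimp only; rw [min_comm]⟩

open scoped Classical in
/-- `D_G(S)`: the total number of detours `S` makes, summed over the edges. -/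
noncomputable def totalDetours (G : SimpleGraph V) (S : List (Finset V)) : ℕ :=
  ∑ e ∈ Finset.univ.filter (· ∈ G.edgeSet), detours S e

/-- `D*(G,I,J)`: the minimum number of detours of a TS-sequence between `I` and `J`. -/
noncomputable def Dstar (G : SimpleGraph V) (I J : Finset V) : ℕ :=
  sInf { d : ℕ | ∃ S, IsTSSeq G I J S ∧ d = totalDetours G S }

/-- The token on `u ∈ I` is `(G, I)`-rigid: `u` belongs to every independent set
reachable from `I`. -/
def RigidToken (G : SimpleGraph V) (I : Finset V) (u : V) : Prop :=
  ∀ I', Reconf G I I' → u ∈ I'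

/-- `G` is a spider with body `v`: a tree with exactly one vertex of degree ≥ 3. -/
def IsSpider (G : SimpleGraph V) (v : V) : Prop :=
  G.IsTree ∧ 3 ≤ (G.neighborSet v).ncard ∧ ∀ w, 3 ≤ (G.neighborSet w).ncard → w = v

/-- For adjacent `x, y` in a tree `T`, `side T x y` is the vertex set of `T^x_y`,
the component of `T − xy` containing `y` (vertices strictly closer to `y` than to `x`). -/
def side (G : SimpleGraph V) (x y : V) : Set V :=
  {z | G.dist z y < G.dist z x}

/-- `|I ∩ V(L)|` for the leg `L` of the spider with body `v` containing the
neighbor `w` of `v`. -/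
noncomputable def legCard (G : SimpleGraph V) (I : Finset V) (v w : V) : ℕ :=
  ((I : Set V) ∩ side G v w).ncard

/-- `|I ∩ V(L)| − |J ∩ V(L)|` for the leg `L` of the spider indexed by the
neighbor `w` of the body `v`. -/
noncomputable def legDiff (G : SimpleGraph V) (I J : Finset V) (v w : V) : ℤ :=
  (legCard G I v w : ℤ) - (legCard G J v w : ℤ)

/-- The leg indexed by the neighbor `w₁` of `v` may serve as `L_1` in a labeling
of the legs making `|I∩V(L_i)| − |J∩V(L_i)|` nondecreasing, i.e. it minimizes the
difference. -/
def IsFirstLeg (G : SimpleGraph V) (I J : Finset V) (v w₁ : V) : Prop :=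
  G.Adj v w₁ ∧ ∀ w, G.Adj v w → legDiff G I J v w₁ ≤ legDiff G I J v w

/-- `I_L` for the leg `L` indexed by the neighbor `w` of the body `v`, where the
first leg (indexed by `w₁`) additionally receives `I ∩ {v}`. -/
noncomputable def ILeg (G : SimpleGraph V) (I : Finset V) (v w₁ w : V) : Set V :=
  ((I : Set V) ∩ side G v w) ∪ (if w = w₁ then (I : Set V) ∩ {v} else ∅)

/-- `|I_L|` for the leg `L` indexed by the neighbor `w` of the body `v`. -/
noncomputable def ILegCard (G : SimpleGraph V) (I : Finset V) (v w₁ w : V) : ℕ :=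
  (ILeg G I v w₁ w).ncard

/-- `S` makes a detour over the edge `ab`: both moves `a → b` and `b → a` occur in `S`. -/
def MakesDetour (S : List (Finset V)) (a b : V) : Prop :=
  0 < moveCount S a b ∧ 0 < moveCount S b a



/-! ### Trees rooted at `v` -/

section RootedTree

variable {W : Type*} {G : SimpleGraph W} {v a b z x : W}

/-- `b` is a child of `a` in the tree `G` rooted at `v`. -/
def IsChild (G : SimpleGraph W) (v a b : W) : Prop :=
  G.Adj a b ∧ G.dist v b = G.dist v a + 1

/-- `x` is a (weak) descendant of `z` in the tree `G` rooted at `v`. -/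
def Desc (G : SimpleGraph W) (v z x : W) : Prop :=
  G.dist v x = G.dist v z + G.dist z x

theorem IsChild.ne (h : IsChild G v a b) : a ≠ b := h.1.ne

theorem isChild_or_isChild (hG : G.IsTree) (v : W) (h : G.Adj a b) :
    IsChild G v a b ∨ IsChild G v b a := by
  rcases hG.dist_eq_dist_add_one_of_adj v h with h' | h'
  · exact Or.inr ⟨h.symm, h'⟩
  · exact Or.inl ⟨h, h'⟩

theorem IsChild.unique_parent (hG : G.IsTree) {a' : W} (h : IsChild G v a b)
    (h' : IsChild G v a' b) : a = a' := by
  have key : ∀ {c : W}, IsChild G v c b → ∃ p : G.Walk v b, p.IsPath ∧ p.penultimate = c := by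
    intro c hc
    obtain ⟨p, hp⟩ := hG.connected.exists_walk_length_eq_dist v c
    refine ⟨p.concat hc.1, ?_, by simp⟩
    apply SimpleGraph.Walk.isPath_of_length_eq_dist
    rw [SimpleGraph.Walk.length_concat, hp, hc.2]
  obtain ⟨p, hp, rfl⟩ := key h
  obtain ⟨q, hq, rfl⟩ := key h'
  rw [(hG.existsUnique_path v b).unique hp hq]

theorem exists_adj_dist (hG : G.IsTree) (h : a ≠ b) :
    ∃ c, G.Adj a c ∧ G.dist a b = G.dist c b + 1 := by
  obtain ⟨p, hp⟩ := hG.connected.exists_walk_length_eq_dist a b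
  cases p with
  | nil => exact absurd rfl h
  | @cons _ c _ hc q =>
    refine ⟨c, hc, ?_⟩
    have h1 := SimpleGraph.dist_le q
    have h2 := hG.connected.dist_triangle (u := a) (v := c) (w := b)
    rw [SimpleGraph.dist_eq_one_iff_adj.2 hc] at h2
    rw [SimpleGraph.Walk.length_cons] at hp
    omega

theorem exists_parent (hG : G.IsTree) (h : b ≠ v) : ∃ a, IsChild G v a b := by
  obtain ⟨a, ha, hd⟩ := exists_adj_dist hG h
  exact ⟨a, ha.symm, by rw [G.dist_comm (u := v), hd, G.dist_comm (u := v)]⟩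

theorem desc_self : Desc G v z z := by simp [Desc]

theorem desc_root : Desc G v v x := by simp [Desc]

theorem IsChild.not_desc (h : IsChild G v a b) : ¬ Desc G v b a := by
  have := h.2
  unfold Desc
  omega

theorem IsChild.desc_iff (hG : G.IsTree) (h : IsChild G v a b) (hz : z ≠ b) :
    Desc G v z b ↔ Desc G v z a := by
  have hab := SimpleGraph.dist_eq_one_iff_adj.2 h.1
  have h2 := h.2
  have htri := fun p q r => hG.connected.dist_triangle (u := p) (v := q) (w := r)
  unfold Desc
  constructor
  · intro hb
    obtain ⟨c, hc, hd⟩ := exists_adj_dist hG hz.symm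
    have hcb := SimpleGraph.dist_eq_one_iff_adj.2 hc.symm
    rw [G.dist_comm (u := b), G.dist_comm (u := c)] at hd
    have t1 := htri v z c
    have t2 := htri v c b
    have : IsChild G v c b := ⟨hc.symm, by omega⟩
    obtain rfl := h.unique_parent hG this
    omega
  · intro ha
    have t1 := htri z a b
    have t2 := htri v z b
    omega

theorem desc_of_isChild_of_desc (hG : G.IsTree) (h : IsChild G v a b) (hx : Desc G v b x) :
    Desc G v a x := by
  have hab := SimpleGraph.dist_eq_one_iff_adj.2 h.1
  have h2 := h.2
  have t1 := hG.connected.dist_triangle (u := a) (v := b) (w := x)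
  have t2 := hG.connected.dist_triangle (u := v) (v := a) (w := x)
  unfold Desc at *
  omega

theorem exists_isChild_desc (hG : G.IsTree) (h : Desc G v z x) (hne : z ≠ x) :
    ∃ u, IsChild G v z u ∧ Desc G v u x := by
  obtain ⟨c, hc, hd⟩ := exists_adj_dist hG hne
  have hzc := SimpleGraph.dist_eq_one_iff_adj.2 hc
  have t1 := hG.connected.dist_triangle (u := v) (v := c) (w := x)
  have t2 := hG.connected.dist_triangle (u := v) (v := z) (w := c)
  unfold Desc at h
  exact ⟨c, ⟨hc, by omega⟩, by unfold Desc; omega⟩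

theorem mem_side_iff_desc (hG : G.IsTree) (h : G.Adj v b) : x ∈ side G v b ↔ Desc G v b x := by
  have hvb := SimpleGraph.dist_eq_one_iff_adj.2 h
  have t1 := hG.connected.dist_triangle (u := v) (v := b) (w := x)
  unfold side Desc
  rw [Set.mem_ofPred_eq, G.dist_comm (u := x), G.dist_comm (u := x)]
  omega

theorem isChild_root_iff : IsChild G v v b ↔ G.Adj v b := by
  refine ⟨And.left, fun h => ⟨h, ?_⟩⟩
  rw [SimpleGraph.dist_self, SimpleGraph.dist_eq_one_iff_adj.2 h]

/-- Apart from its body, every vertex of a spider has at most one child. -/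
theorem IsSpider.unique_child [Finite W] (hG : IsSpider G v) {b' : W} (hz : z ≠ v) (h : IsChild G v z b)
    (h' : IsChild G v z b') : b = b' := by
  obtain ⟨p, hp⟩ := exists_parent hG.1 hz
  by_contra hne
  classical
  apply hz
  apply hG.2.2
  have h1 := h.2
  have h2 := h'.2
  have h3 := hp.2
  have hpb : p ≠ b := by rintro rfl; omega
  have hpb' : p ≠ b' := by rintro rfl; omega
  have hc : ({p, b, b'} : Finset W).card = 3 := by
    rw [Finset.card_eq_three]
    exact ⟨p, b, b', hpb, hpb', hne, rfl⟩
  rw [← hc, ← Set.ncard_coe_finset]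
  apply Set.ncard_le_ncard _ (Set.toFinite _)
  intro y hy
  simp only [Finset.coe_insert, Finset.coe_singleton, Set.mem_insert_iff,
    Set.mem_singleton_iff] at hy
  rcases hy with rfl | rfl | rfl
  · exact hp.1.symm
  · exact h.1
  · exact h'.1

end RootedTree

/-! ### Token counts and the potential -/

section Potential

variable {W : Type*} {G : SimpleGraph W} {v a b z x y : W} {I J A B : Finset W}

open scoped Classical in
/-- The indicator of `x` being a descendant of `z`. -/
noncomputable def descInd (G : SimpleGraph W) (v z x : W) : ℤ := if Desc G v z x then 1 else 0

/-- The number of tokens of `I` on the descendants of `z`. -/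
noncomputable def descCount (G : SimpleGraph W) (v : W) (I : Finset W) (z : W) : ℤ :=
  ∑ x ∈ I, descInd G v z x

/-- The surplus of `I` over `J` on the descendants of `z`. -/
noncomputable def surplus (G : SimpleGraph W) (v : W) (I J : Finset W) (z : W) : ℤ :=
  descCount G v I z - descCount G v J z

/-- Each edge of a rooted tree corresponds to its lower endpoint `z`; it has to be crossed by at
least `|surplus z|` tokens. -/
noncomputable def potential [Fintype W] (G : SimpleGraph W) (v : W) (I J : Finset W) : ℤ :=
  ∑ z, |surplus G v I J z|

theorem surplus_self : surplus G v I I z = 0 := sub_self _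

theorem surplus_swap : surplus G v J I z = -surplus G v I J z := (neg_sub _ _).symm

theorem potential_swap [Fintype W] : potential G v J I = potential G v I J := by
  simp only [potential, surplus_swap (I := I) (J := J), abs_neg]

theorem IsChild.descInd_eq [DecidableEq W] (hG : G.IsTree) (h : IsChild G v a b) (z : W) :
    descInd G v z b = descInd G v z a + if z = b then 1 else 0 := by
  unfold descInd
  by_cases hz : z = b
  · subst hz
    simp [desc_self, h.not_desc]
  · rw [if_neg hz, add_zero]
    classical exact if_congr (h.desc_iff hG hz) rfl rfl

theorem descCount_of_sdiff [DecidableEq W] (hA : A \ B = {x}) (hB : B \ A = {y}) (z : W) :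
    descCount G v B z = descCount G v A z - descInd G v z x + descInd G v z y := by
  have h1 := Finset.sum_inter_add_sum_sdiff A B (descInd G v z)
  have h2 := Finset.sum_inter_add_sum_sdiff B A (descInd G v z)
  rw [hA, Finset.sum_singleton] at h1
  rw [hB, Finset.sum_singleton, Finset.inter_comm] at h2
  unfold descCount
  linarith

theorem surplus_of_sdiff_child [DecidableEq W] (hG : G.IsTree) (h : IsChild G v a b) (hA : A \ B = {a})
    (hB : B \ A = {b}) (z : W) :
    surplus G v B J z = surplus G v A J z + if z = b then 1 else 0 := by
  rw [surplus, surplus, descCount_of_sdiff hA hB, h.descInd_eq hG]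
  ring

theorem surplus_of_sdiff_parent [DecidableEq W] (hG : G.IsTree) (h : IsChild G v a b) (hA : A \ B = {b})
    (hB : B \ A = {a}) (z : W) :
    surplus G v B J z = surplus G v A J z - if z = b then 1 else 0 := by
  rw [surplus, surplus, descCount_of_sdiff hA hB, h.descInd_eq hG]
  ring

theorem surplus_root (h : I.card = J.card) : surplus G v I J v = 0 := by
  simp [surplus, descCount, descInd, desc_root, h]

theorem sum_abs_descInd_sub_le_length [Fintype W] (hG : G.IsTree) (p : G.Walk x y) :
    ∑ z, |descInd G v z x - descInd G v z y| ≤ p.length := by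
  classical
  induction p with
  | nil => simp
  | @cons a b c h p ih =>
    have h1 : ∑ z, |descInd G v z a - descInd G v z b| ≤ 1 := by
      rcases isChild_or_isChild hG v h with h' | h'
      · simp [h'.descInd_eq hG, apply_ite abs]
      · simp [h'.descInd_eq hG, apply_ite abs]
    have h2 : ∑ z, |descInd G v z a - descInd G v z c| ≤
        ∑ z, |descInd G v z a - descInd G v z b| + ∑ z, |descInd G v z b - descInd G v z c| := by
      rw [← Finset.sum_add_distrib]
      exact Finset.sum_le_sum fun z _ => abs_sub_le _ _ _
    rw [SimpleGraph.Walk.length_cons]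
    push_cast
    linarith

/-- The potential bounds the cost of every target assignment from below. -/
theorem potential_le_sum_dist [Fintype W] (hG : G.IsTree) (e : {x // x ∈ I} ≃ {y // y ∈ J}) :
    potential G v I J ≤ ((∑ x : {x // x ∈ I}, G.dist (x : W) (e x : W) : ℕ) : ℤ) := by
  have hs : ∀ z, surplus G v I J z =
      ∑ x : {x // x ∈ I}, (descInd G v z x - descInd G v z (e x)) := by
    intro z
    rw [Finset.sum_sub_distrib, e.sum_comp (fun y : {y // y ∈ J} => descInd G v z y),
      Finset.sum_coe_sort I (descInd G v z), Finset.sum_coe_sort J (descInd G v z)]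
    rfl
  calc potential G v I J
      ≤ ∑ z, ∑ x : {x // x ∈ I}, |descInd G v z x - descInd G v z (e x)| := by
        refine Finset.sum_le_sum fun z _ => ?_
        rw [hs]
        exact Finset.abs_sum_le_sum_abs _ _
    _ = ∑ x : {x // x ∈ I}, ∑ z, |descInd G v z x - descInd G v z (e x)| := Finset.sum_comm
    _ ≤ ∑ x : {x // x ∈ I}, (G.dist (x : W) (e x : W) : ℤ) := by
        refine Finset.sum_le_sum fun x _ => ?_
        obtain ⟨p, hp⟩ := hG.connected.exists_walk_length_eq_dist (x : W) (e x : W)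
        rw [← hp]
        exact sum_abs_descInd_sub_le_length hG p
    _ = _ := by push_cast; rfl

end Potential

/-! ### TS-sequences of a given length -/

section Sequences

variable {W : Type*} [DecidableEq W] {G : SimpleGraph W} {v a b z x y : W} {I J A B : Finset W}

/-- There is a TS-sequence of length `n` between `I` and `J`. -/
def HasTSSeq (G : SimpleGraph W) (n : ℕ) (I J : Finset W) : Prop :=
  ∃ S, IsTSSeq G I J S ∧ len S = n

theorem Step.symm (h : Step G A B) : Step G B A := by
  obtain ⟨x, y, hxy, hA, hB⟩ := h
  exact ⟨y, x, hxy.symm, hB, hA⟩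

theorem Step.card_eq (h : Step G A B) : A.card = B.card := by
  obtain ⟨x, y, -, hA, hB⟩ := h
  have h1 := Finset.card_sdiff_add_card_inter A B
  have h2 := Finset.card_sdiff_add_card_inter B A
  rw [hA, Finset.card_singleton] at h1
  rw [hB, Finset.card_singleton, Finset.inter_comm] at h2
  omega

theorem step_insert_erase (h : G.Adj x y) (hx : x ∈ A) (hy : y ∉ A) :
    Step G A (insert y (A.erase x)) := by
  have hne := h.ne
  refine ⟨x, y, h, ?_, ?_⟩ <;> ext z <;>
    simp only [Finset.mem_sdiff, Finset.mem_insert, Finset.mem_erase, Finset.mem_singleton] <;>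
    grind

theorem HasTSSeq.refl (h : IsIndep G I) : HasTSSeq G 0 I I :=
  ⟨[I], ⟨by simp, rfl, rfl, by simpa using h, List.isChain_singleton I⟩, rfl⟩

theorem HasTSSeq.cons {n : ℕ} (hI : IsIndep G I) (hs : Step G I A) (h : HasTSSeq G n A J) :
    HasTSSeq G (n + 1) I J := by
  obtain ⟨S, ⟨hne, hh, hl, hS, hc⟩, rfl⟩ := h
  obtain ⟨T, rfl⟩ : ∃ T, S = A :: T := by
    cases S with
    | nil => exact absurd rfl hne
    | cons B T => exact ⟨T, by simpa using hh⟩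
  refine ⟨I :: A :: T, ⟨by simp, rfl, by simpa using hl, ?_, ?_⟩, by simp [len]⟩
  · rw [List.forall_mem_cons]
    refine ⟨⟨hI, rfl⟩, fun B hB => ?_⟩
    rw [hs.card_eq]
    exact hS B hB
  · exact List.IsChain.cons_cons hs hc

theorem HasTSSeq.symm {n : ℕ} (h : HasTSSeq G n I J) : HasTSSeq G n J I := by
  obtain ⟨S, ⟨hne, hh, hl, hS, hc⟩, rfl⟩ := h
  have hJ : J.card = I.card := (hS J (List.mem_of_getLast? hl)).2
  refine ⟨S.reverse, ⟨by simpa using hne, by simpa using hl, by simpa using hh, ?_, ?_⟩,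
    by simp [len]⟩
  · intro B hB
    rw [hJ]
    exact hS B (List.mem_reverse.1 hB)
  · exact List.isChain_reverse.2 (hc.imp fun _ _ => Step.symm)

theorem moveCount_cons_cons (S : List (Finset W)) :
    moveCount (A :: B :: S) x y =
      (if A \ B = {x} ∧ B \ A = {y} then 1 else 0) + moveCount (B :: S) x y := by
  unfold moveCount
  by_cases h : A \ B = {x} ∧ B \ A = {y} <;> simp [h, add_comm]

variable [Fintype W]

theorem surplus_eq_and_sum_add_moveCount_le (hG : G.IsTree) (hab : IsChild G v a b)
    (T : List (Finset W)) (I : Finset W) (hl : (I :: T).getLast? = some J)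
    (hc : (I :: T).IsChain (Step G)) :
    surplus G v I J b = (moveCount (I :: T) b a : ℤ) - moveCount (I :: T) a b ∧
      ∑ z ∈ Finset.univ.erase b, |surplus G v I J z| + moveCount (I :: T) a b
        + moveCount (I :: T) b a ≤ T.length := by
  induction T generalizing I with
  | nil =>
    obtain rfl : I = J := by simpa using hl
    simp [surplus_self, moveCount]
  | cons A T ih =>
    rw [List.isChain_cons_cons] at hc
    obtain ⟨⟨x, y, hxy, hx, hy⟩, hc⟩ := hc
    obtain ⟨ih1, ih2⟩ := ih A (by simpa using hl) hc
    rw [moveCount_cons_cons, moveCount_cons_cons, hx, hy]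
    simp only [Finset.singleton_inj, List.length_cons]
    have step_le : ∀ c, (∀ z, |surplus G v I J z - surplus G v A J z| = if z = c then 1 else 0) →
        ∑ z ∈ Finset.univ.erase b, |surplus G v I J z| ≤
          ∑ z ∈ Finset.univ.erase b, |surplus G v A J z| + if c = b then 0 else 1 := by
      intro c hc
      have : (if c = b then (0 : ℤ) else 1) =
          ∑ z ∈ Finset.univ.erase b, if z = c then 1 else 0 := by
        rw [Finset.sum_ite_eq']
        simp
      rw [this, ← Finset.sum_add_distrib]
      refine Finset.sum_le_sum fun z _ => ?_
      rw [← hc z]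
      have := abs_sub_abs_le_abs_sub (surplus G v I J z) (surplus G v A J z)
      linarith
    rcases isChild_or_isChild hG v hxy with h | h
    · have hs := surplus_of_sdiff_child (J := J) hG h hx hy
      have hle := step_le y fun z => by rw [hs, abs_sub_comm]; simp [apply_ite abs]
      have hba : ¬(x = b ∧ y = a) := by
        rintro ⟨rfl, rfl⟩
        have := h.2
        have := hab.2
        omega
      have hiff : x = a ∧ y = b ↔ y = b :=
        ⟨And.right, fun hyb => ⟨h.unique_parent hG (hyb ▸ hab), hyb⟩⟩
      have hsb := hs b
      simp only [hba, hiff, if_false]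
      by_cases hyb : y = b
      · simp only [hyb, if_true] at *
        push_cast
        constructor <;> linarith
      · simp only [hyb, Ne.symm hyb, if_false] at *
        push_cast
        constructor <;> linarith
    · have hs := surplus_of_sdiff_parent (J := J) hG h hx hy
      have hle := step_le x fun z => by rw [hs]; simp [apply_ite abs]
      have hba : ¬(x = a ∧ y = b) := by
        rintro ⟨rfl, rfl⟩
        have := h.2
        have := hab.2
        omega
      have hiff : x = b ∧ y = a ↔ x = b :=
        ⟨And.left, fun hxb => ⟨hxb, h.unique_parent hG (hxb ▸ hab)⟩⟩
      have hsb := hs b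
      simp only [hba, hiff, if_false]
      by_cases hxb : x = b
      · simp only [hxb, if_true] at *
        push_cast
        constructor <;> linarith
      · simp only [hxb, Ne.symm hxb, if_false] at *
        push_cast
        constructor <;> linarith

/-- Detours over an edge make a TS-sequence longer than the potential. -/
theorem IsTSSeq.potential_add_detours_le (hG : G.IsTree) (hab : IsChild G v a b)
    {S : List (Finset W)} (h : IsTSSeq G I J S) :
    potential G v I J + detours S s(a, b) ≤ len S := by
  obtain ⟨hne, hh, hl, -, hc⟩ := h
  obtain ⟨T, rfl⟩ : ∃ T, S = I :: T := by
    cases S with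
    | nil => exact absurd rfl hne
    | cons B T => exact ⟨T, by simpa using hh⟩
  obtain ⟨h1, h2⟩ := surplus_eq_and_sum_add_moveCount_le hG hab T I hl hc
  have h3 : potential G v I J =
      |surplus G v I J b| + ∑ z ∈ Finset.univ.erase b, |surplus G v I J z| :=
    (Finset.add_sum_erase _ _ (Finset.mem_univ b)).symm
  have h4 : detours (I :: T) s(a, b) =
      2 * min (moveCount (I :: T) a b) (moveCount (I :: T) b a) := rfl
  have h5 : len (I :: T) = T.length := by simp [len]
  rw [h3, h4, h5, h1]
  rcases le_total (moveCount (I :: T) a b) (moveCount (I :: T) b a) with h | h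
  · rw [min_eq_left h, abs_of_nonneg (by omega)]
    push_cast
    linarith
  · rw [min_eq_right h, abs_of_nonpos (by omega)]
    push_cast
    linarith

theorem IsTSSeq.totalDetours_eq_zero (hG : G.IsTree) {S : List (Finset W)}
    (h : IsTSSeq G I J S) (hlen : (len S : ℤ) = potential G v I J) : totalDetours G S = 0 := by
  classical
  refine Finset.sum_eq_zero fun e he => ?_
  have he' : e ∈ G.edgeSet := by simpa using he
  induction e with
  | h a b =>
    rcases isChild_or_isChild hG v (G.mem_edgeSet.1 he') with hab | hab
    · have := h.potential_add_detours_le hG hab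
      omega
    · have := h.potential_add_detours_le hG hab
      rw [Sym2.eq_swap]
      omega

omit [Fintype W] in
/-- A TS-sequence moves the tokens according to some target assignment. -/
theorem exists_equiv_sum_dist_le (hG : G.Connected) (T : List (Finset W)) (I : Finset W)
    (hl : (I :: T).getLast? = some J) (hc : (I :: T).IsChain (Step G)) :
    ∃ e : {x // x ∈ I} ≃ {y // y ∈ J},
      ∑ x : {x // x ∈ I}, G.dist (x : W) (e x : W) ≤ T.length := by
  induction T generalizing I with
  | nil =>
    obtain rfl : I = J := by simpa using hl
    exact ⟨Equiv.refl _, by simp⟩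
  | cons A T ih =>
    rw [List.isChain_cons_cons] at hc
    obtain ⟨⟨x, y, hxy, hx, hy⟩, hc⟩ := hc
    obtain ⟨e, he⟩ := ih A (by simpa using hl) hc
    have hxI : x ∈ I ∧ x ∉ A := Finset.mem_sdiff.1 (hx ▸ Finset.mem_singleton_self x)
    have hyA : y ∈ A ∧ y ∉ I := Finset.mem_sdiff.1 (hy ▸ Finset.mem_singleton_self y)
    have hI : ∀ z, z ∈ I → z ∉ A → z = x := fun z h1 h2 =>
      Finset.mem_singleton.1 (hx ▸ Finset.mem_sdiff.2 ⟨h1, h2⟩)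
    have hA : ∀ z, z ∈ A → z ∉ I → z = y := fun z h1 h2 =>
      Finset.mem_singleton.1 (hy ▸ Finset.mem_sdiff.2 ⟨h1, h2⟩)
    have hswap : ∀ z, z ∈ I ↔ Equiv.swap x y z ∈ A := by
      intro z
      rcases eq_or_ne z x with rfl | hzx
      · simp [hxI.1, hyA.1]
      rcases eq_or_ne z y with rfl | hzy
      · simp [hxI.2, hyA.2]
      rw [Equiv.swap_apply_of_ne_of_ne hzx hzy]
      exact ⟨fun h => by_contra fun h' => hzx (hI z h h'),
        fun h => by_contra fun h' => hzy (hA z h h')⟩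
    let e₁ : {x // x ∈ I} ≃ {y // y ∈ A} := (Equiv.swap x y).subtypeEquiv hswap
    have hcost : ∑ z : {x // x ∈ I}, G.dist (z : W) (e₁ z : W) = 1 := by
      rw [Finset.sum_eq_single ⟨x, hxI.1⟩]
      · simpa [e₁] using SimpleGraph.dist_eq_one_iff_adj.2 hxy
      · rintro ⟨z, hz⟩ - hne
        have hzx : z ≠ x := fun h => hne (Subtype.ext h)
        have hzy : z ≠ y := fun h => hyA.2 (h ▸ hz)
        simp [e₁, Equiv.swap_apply_of_ne_of_ne hzx hzy]
      · simp
    refine ⟨e₁.trans e, ?_⟩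
    calc ∑ z : {x // x ∈ I}, G.dist (z : W) (e₁.trans e z : W)
        ≤ ∑ z : {x // x ∈ I}, (G.dist (z : W) (e₁ z : W) + G.dist (e₁ z : W) (e (e₁ z) : W)) :=
          Finset.sum_le_sum fun z _ => hG.dist_triangle
      _ = 1 + ∑ z : {x // x ∈ A}, G.dist (z : W) (e z : W) := by
          rw [Finset.sum_add_distrib, hcost,
            e₁.sum_comp fun z : {x // x ∈ A} => G.dist (z : W) (e z : W)]
      _ ≤ _ := by
          rw [List.length_cons]
          omega

/-- A TS-sequence whose length is the potential is a shortest one. -/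
theorem IsTSSeq.len_eq_Mstar (hG : G.IsTree) {S : List (Finset W)}
    (h : IsTSSeq G I J S) (hlen : (len S : ℤ) = potential G v I J) : len S = Mstar G I J := by
  obtain ⟨hne, hh, hl, -, hc⟩ := h
  obtain ⟨T, rfl⟩ : ∃ T, S = I :: T := by
    cases S with
    | nil => exact absurd rfl hne
    | cons B T => exact ⟨T, by simpa using hh⟩
  obtain ⟨e, he⟩ := exists_equiv_sum_dist_le hG.connected T I hl hc
  have h5 : len (I :: T) = T.length := by simp [len]
  apply le_antisymm
  · refine le_csInf ⟨_, e, rfl⟩ ?_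
    rintro m ⟨e', rfl⟩
    have := potential_le_sum_dist (v := v) hG e'
    omega
  · rw [h5]
    refine le_trans (Nat.sInf_le ?_) he
    exact ⟨e, rfl⟩

end Sequences

/-! ### Sliding tokens down the legs of a spider -/

section Spider

variable {W : Type*} [Fintype W] [DecidableEq W] {G : SimpleGraph W} {v m u y z : W}
  {I J : Finset W}

omit [Fintype W] in
theorem descCount_leaf (hG : G.IsTree) (hz : ∀ u, ¬ IsChild G v z u) :
    descCount G v I z = if z ∈ I then 1 else 0 := by
  have : ∀ x, descInd G v z x = if z = x then 1 else 0 := by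
    intro x
    by_cases hx : z = x
    · subst hx
      simp [descInd, desc_self]
    · have : ¬ Desc G v z x := fun h => by
        obtain ⟨u, hu, -⟩ := exists_isChild_desc hG h hx
        exact hz u hu
      simp [descInd, this, hx]
  simp [descCount, this]

theorem descCount_of_isChild (hG : IsSpider G v) (hz : z ≠ v) (hu : IsChild G v z u) :
    descCount G v I z = (if z ∈ I then 1 else 0) + descCount G v I u := by
  have : ∀ x, descInd G v z x = (if z = x then 1 else 0) + descInd G v u x := by
    intro x
    by_cases hx : z = x
    · subst hx
      simp [descInd, desc_self, hu.not_desc]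
    · have : Desc G v z x ↔ Desc G v u x := by
        refine ⟨fun h => ?_, desc_of_isChild_of_desc hG.1 hu⟩
        obtain ⟨u', hu', h'⟩ := exists_isChild_desc hG.1 h hx
        rwa [hG.unique_child hz hu hu']
      rw [if_neg hx, zero_add]
      classical exact if_congr this rfl rfl
  simp [descCount, this, Finset.sum_add_distrib]

omit [Fintype W] in
theorem surplus_leaf (hG : G.IsTree) (hz : ∀ u, ¬ IsChild G v z u) :
    surplus G v I J z = (if z ∈ I then 1 else 0) - (if z ∈ J then 1 else 0) := by
  rw [surplus, descCount_leaf hG hz, descCount_leaf hG hz]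

theorem surplus_of_isChild (hG : IsSpider G v) (hz : z ≠ v) (hu : IsChild G v z u) :
    surplus G v I J z =
      (if z ∈ I then 1 else 0) - (if z ∈ J then 1 else 0) + surplus G v I J u := by
  rw [surplus, descCount_of_isChild hG hz hu, descCount_of_isChild hG hz hu, surplus]
  ring

theorem eq_of_surplus_eq_zero (hG : IsSpider G v) (hcard : I.card = J.card)
    (h : ∀ z, surplus G v I J z = 0) : I = J := by
  have key : ∀ z, z ≠ v → (z ∈ I ↔ z ∈ J) := by
    intro z hz
    have h0 := h z
    by_cases hc : ∃ u, IsChild G v z u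
    · obtain ⟨u, hu⟩ := hc
      rw [surplus_of_isChild hG hz hu, h u] at h0
      by_cases h1 : z ∈ I <;> by_cases h2 : z ∈ J <;> simp_all
    · rw [surplus_leaf hG.1 (not_exists.1 hc)] at h0
      by_cases h1 : z ∈ I <;> by_cases h2 : z ∈ J <;> simp_all
  by_cases hvJ : v ∈ J
  · refine Finset.eq_of_subset_of_card_le (fun z hz => ?_) hcard.ge
    by_cases hzv : z = v
    · exact hzv ▸ hvJ
    · exact (key z hzv).1 hz
  · refine (Finset.eq_of_subset_of_card_le (fun z hz => ?_) hcard.le).symm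
    exact (key z (fun h => hvJ (h ▸ hz))).2 hz

/-- Some token above an empty vertex `y` with negative surplus can slide down its leg. -/
theorem exists_slide_above (hG : IsSpider G v) (hI : IsIndep G I)
    (hv : ∀ w, G.Adj v w → surplus G v I J w < 0 → v ∈ I)
    (y : W) (hyv : y ≠ v) (hy : surplus G v I J y < 0) (hyI : y ∉ I)
    (hch : ∀ u, IsChild G v y u → u ∉ I) :
    ∃ m y, IsChild G v m y ∧ m ∈ I ∧ y ∉ I ∧ surplus G v I J y < 0 ∧
      IsIndep G (insert y (I.erase m)) := by
  induction hd : G.dist v y generalizing y with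
  | zero => exact absurd (hG.1.connected.dist_eq_zero_iff.1 hd).symm hyv
  | succ d ih =>
    obtain ⟨m, hm⟩ := exists_parent hG.1 hyv
    by_cases hmI : m ∈ I
    · refine ⟨m, y, hm, hmI, hyI, hy, ?_⟩
      have hnot : ∀ x ∈ I.erase m, ¬ G.Adj y x := by
        intro x hx hadj
        rw [Finset.mem_erase] at hx
        rcases isChild_or_isChild hG.1 v hadj with h | h
        · exact hch x h hx.2
        · exact hx.1 (h.unique_parent hG.1 hm)
      intro p hp q hq
      rw [Finset.mem_insert] at hp hq
      rcases hp with rfl | hp <;> rcases hq with rfl | hq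
      · exact G.irrefl
      · exact hnot q hq
      · exact fun h => hnot p hp h.symm
      · exact hI p (Finset.mem_of_mem_erase hp) q (Finset.mem_of_mem_erase hq)
    · have hmv : m ≠ v := by
        rintro rfl
        exact hmI (hv y hm.1 hy)
      refine ih m hmv ?_ hmI ?_ ?_
      · rw [surplus_of_isChild hG hmv hm, if_neg hmI]
        split_ifs <;> linarith
      · intro u hu
        rwa [hG.unique_child hmv hu hm]
      · have := hm.2
        omega

/-- If some surplus is negative, then some token can slide down its leg, lowering the potential. -/
theorem exists_slide (hG : IsSpider G v) (hI : IsIndep G I) (hJ : IsIndep G J)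
    (hv : ∀ w, G.Adj v w → surplus G v I J w < 0 → v ∈ I)
    (hzv : z ≠ v) (hz : surplus G v I J z < 0) :
    ∃ m y, IsChild G v m y ∧ m ∈ I ∧ y ∉ I ∧ surplus G v I J y < 0 ∧
      IsIndep G (insert y (I.erase m)) := by
  obtain ⟨n, hn, hmax⟩ := Finset.exists_max_image
    (Finset.univ.filter fun x => x ≠ v ∧ surplus G v I J x < 0) (G.dist v)
    ⟨z, by simp [hzv, hz]⟩
  simp only [Finset.mem_filter, Finset.mem_univ, true_and] at hn hmax
  obtain ⟨hnv, hneg⟩ := hn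
  have hpos : ∀ x u, IsChild G v x u → G.dist v n ≤ G.dist v x → 0 ≤ surplus G v I J u := by
    intro x u hu hle
    by_contra hlt
    have h2 := hu.2
    have := hmax u ⟨fun h => by rw [h, SimpleGraph.dist_self] at h2; omega, not_le.1 hlt⟩
    omega
  have hnJ : n ∉ I ∧ n ∈ J := by
    by_cases hc : ∃ u, IsChild G v n u
    · obtain ⟨u, hu⟩ := hc
      have := hpos n u hu le_rfl
      rw [surplus_of_isChild hG hnv hu] at hneg
      split_ifs at hneg <;> grind
    · rw [surplus_leaf hG.1 (not_exists.1 hc)] at hneg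
      split_ifs at hneg <;> grind
  refine exists_slide_above hG hI hv n hnv hneg hnJ.1 fun u hu huI => ?_
  have huJ : u ∉ J := fun h => hJ n hnJ.2 u h hu.1
  have huv : u ≠ v := by
    rintro rfl
    have := hu.2
    rw [SimpleGraph.dist_self] at this
    omega
  have hu0 : surplus G v I J u < 1 := by
    rw [surplus_of_isChild hG hnv hu, if_neg hnJ.1, if_pos hnJ.2] at hneg
    linarith
  by_cases hc : ∃ t, IsChild G v u t
  · obtain ⟨t, ht⟩ := hc
    have h1 := hpos u t ht (by have := hu.2; omega)
    rw [surplus_of_isChild hG huv ht, if_pos huI, if_neg huJ] at hu0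
    linarith
  · rw [surplus_leaf hG.1 (not_exists.1 hc), if_pos huI, if_neg huJ] at hu0
    norm_num at hu0

omit [Fintype W] in
theorem surplus_slide (hG : G.IsTree) (h : IsChild G v m y) (hm : m ∈ I) (hy : y ∉ I) (z : W) :
    surplus G v (insert y (I.erase m)) J z = surplus G v I J z + if z = y then 1 else 0 := by
  have hne := h.ne
  apply surplus_of_sdiff_child hG h <;> ext x <;>
    simp only [Finset.mem_sdiff, Finset.mem_insert, Finset.mem_erase, Finset.mem_singleton] <;>
    grind

theorem potential_slide (hG : G.IsTree) (h : IsChild G v m y) (hm : m ∈ I) (hy : y ∉ I)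
    (hneg : surplus G v I J y < 0) :
    potential G v (insert y (I.erase m)) J = potential G v I J - 1 := by
  have : ∀ z, |surplus G v (insert y (I.erase m)) J z| =
      |surplus G v I J z| - if z = y then 1 else 0 := by
    intro z
    rw [surplus_slide hG h hm hy]
    split_ifs with hz
    · subst hz
      rw [abs_of_neg hneg, abs_of_nonpos (by omega)]
      ring
    · simp
  simp [potential, this, Finset.sum_sub_distrib]

omit [DecidableEq W] in
theorem exists_surplus_ne_zero (h : potential G v I J ≠ 0) : ∃ z, surplus G v I J z ≠ 0 := by
  by_contra! h'
  simp [potential, h'] at h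

/-- Sets with the same number of tokens on each leg are joined by a sequence whose length is the
potential. -/
theorem hasTSSeq_of_balanced (hG : IsSpider G v) (n : ℕ) (I J : Finset W) (hI : IsIndep G I)
    (hJ : IsIndep G J) (hcard : I.card = J.card) (hbal : ∀ w, G.Adj v w → surplus G v I J w = 0)
    (hn : potential G v I J = n) : HasTSSeq G n I J := by
  induction n generalizing I J with
  | zero =>
    have h0 : ∀ z, surplus G v I J z = 0 := by
      intro z
      have := (Finset.sum_eq_zero_iff_of_nonneg (fun z _ => abs_nonneg (surplus G v I J z))).1
        (by simpa [potential] using hn) z (Finset.mem_univ z)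
      exact abs_eq_zero.1 this
    obtain rfl := eq_of_surplus_eq_zero hG hcard h0
    exact HasTSSeq.refl hI
  | succ n ih =>
    have down : ∀ I J : Finset W, IsIndep G I → IsIndep G J → I.card = J.card →
        (∀ w, G.Adj v w → surplus G v I J w = 0) → potential G v I J = (n + 1 : ℕ) →
        (∃ z, surplus G v I J z < 0) → HasTSSeq G (n + 1) I J := by
      rintro I J hI hJ hcard hbal hn ⟨z, hz⟩
      have hzv : z ≠ v := by
        rintro rfl
        rw [surplus_root hcard] at hz
        omega
      obtain ⟨m, y, hmy, hm, hy, hneg, hind⟩ := exists_slide hG hI hJ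
        (fun w hw h => absurd (hbal w hw) h.ne) hzv hz
      have hstep := step_insert_erase hmy.1 hm hy
      refine HasTSSeq.cons hI hstep (ih _ _ hind hJ (hstep.card_eq.symm.trans hcard) ?_ ?_)
      · intro w hw
        have hwy : w ≠ y := fun h => hneg.ne (h ▸ hbal w hw)
        rw [surplus_slide hG.1 hmy hm hy, if_neg hwy, hbal w hw, add_zero]
      · rw [potential_slide hG.1 hmy hm hy hneg, hn]
        push_cast
        ring
    obtain ⟨z, hz⟩ := exists_surplus_ne_zero (G := G) (v := v) (I := I) (J := J) (by omega)
    rcases lt_or_gt_of_ne hz with hz | hz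
    · exact down I J hI hJ hcard hbal hn ⟨z, hz⟩
    · refine (down J I hJ hI hcard.symm (fun w hw => ?_) (potential_swap.trans hn) ⟨z, ?_⟩).symm
      · rw [surplus_swap, hbal w hw, neg_zero]
      · rw [surplus_swap]
        omega

/-- If the token on the body has to enter the leg at `w₁`, there still is a sequence whose length is
the potential. -/
theorem hasTSSeq_of_body_token (hG : IsSpider G v) {w₁ : W} (hw₁ : G.Adj v w₁) (n : ℕ)
    (I J : Finset W) (hI : IsIndep G I) (hJ : IsIndep G J) (hcard : I.card = J.card) (hvI : v ∈ I)
    (hleg : ∀ w, G.Adj v w → surplus G v I J w = if w = w₁ then -1 else 0)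
    (hn : potential G v I J = n) : HasTSSeq G n I J := by
  have hw₁neg : surplus G v I J w₁ < 0 := by
    rw [hleg w₁ hw₁, if_pos rfl]
    norm_num
  induction n generalizing I with
  | zero =>
    have := (Finset.sum_eq_zero_iff_of_nonneg (fun z _ => abs_nonneg (surplus G v I J z))).1
        (by simpa [potential] using hn) w₁ (Finset.mem_univ w₁)
    exact absurd (abs_eq_zero.1 this) hw₁neg.ne
  | succ n ih =>
    obtain ⟨m, y, hmy, hm, hy, hneg, hind⟩ := exists_slide hG hI hJ
      (fun _ _ _ => hvI) hw₁.ne' hw₁neg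
    have hstep := step_insert_erase hmy.1 hm hy
    have hcard' := hstep.card_eq.symm.trans hcard
    have hpot : potential G v (insert y (I.erase m)) J = n := by
      rw [potential_slide hG.1 hmy hm hy hneg, hn]
      push_cast
      ring
    refine HasTSSeq.cons hI hstep ?_
    by_cases hmv : m = v
    · subst hmv
      have hyw : y = w₁ := by
        by_contra hne
        rw [hleg y hmy.1, if_neg hne] at hneg
        omega
      subst hyw
      refine hasTSSeq_of_balanced hG n _ _ hind hJ hcard' (fun w hw => ?_) hpot
      rw [surplus_slide hG.1 hmy hm hy, hleg w hw]
      split_ifs <;> norm_num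
    · have hadj : ∀ w, G.Adj v w → w ≠ y := by
        rintro w hw rfl
        exact hmv (hmy.unique_parent hG.1 (isChild_root_iff.2 hw))
      refine ih _ hind hcard' ?_ ?_ hpot ?_
      · exact Finset.mem_insert_of_mem (Finset.mem_erase.2 ⟨Ne.symm hmv, hvI⟩)
      · intro w hw
        rw [surplus_slide hG.1 hmy hm hy, if_neg (hadj w hw), add_zero, hleg w hw]
      · rw [surplus_slide hG.1 hmy hm hy, if_neg (hadj w₁ hw₁), add_zero]
        exact hw₁neg

omit [Fintype W] [DecidableEq W] in
theorem legCard_eq_descCount (hG : G.IsTree) {w : W} (hw : G.Adj v w) :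
    (legCard G I v w : ℤ) = descCount G v I w := by
  classical
  have : (I : Set W) ∩ side G v w = ↑(I.filter (Desc G v w)) := by
    ext x
    simp [mem_side_iff_desc hG hw]
  rw [legCard, this, Set.ncard_coe_finset, Finset.card_filter]
  simp [descCount, descInd]

omit [Fintype W] [DecidableEq W] in
theorem legDiff_eq_surplus (hG : G.IsTree) {w : W} (hw : G.Adj v w) :
    legDiff G I J v w = surplus G v I J w := by
  rw [legDiff, legCard_eq_descCount hG hw, legCard_eq_descCount hG hw, surplus]

theorem ILegCard_eq_descCount (hG : G.IsTree) (w₁ : W) {w : W} (hw : G.Adj v w) :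
    (ILegCard G I v w₁ w : ℤ) =
      descCount G v I w + if w = w₁ then (if v ∈ I then 1 else 0) else 0 := by
  rw [← legCard_eq_descCount hG hw, ILegCard, ILeg, legCard]
  by_cases hww : w = w₁
  · by_cases hv : v ∈ I
    · have hside : v ∉ side G v w := by
        rw [mem_side_iff_desc hG hw]
        exact (isChild_root_iff.2 hw).not_desc
      rw [if_pos hww, Set.inter_eq_right.2 (Set.singleton_subset_iff.2 (Finset.mem_coe.2 hv)),
        Set.ncard_union_eq (by simp [hside])]
      simp [hww, hv]
    · simp [hww, hv]
  · simp [hww]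

theorem HasTSSeq.shortest_no_detours (hG : G.IsTree) {n : ℕ} (h : HasTSSeq G n I J)
    (hn : potential G v I J = n) :
    (∃ S, IsTSSeq G I J S ∧ len S = Mstar G I J) ∧ Dstar G I J = 0 := by
  obtain ⟨S, hS, rfl⟩ := h
  refine ⟨⟨S, hS, hS.len_eq_Mstar hG hn.symm⟩, ?_⟩
  exact Nat.sInf_eq_zero.2 (Or.inl ⟨S, hS, (hS.totalDetours_eq_zero hG hn.symm).symm⟩)

omit [DecidableEq W] in
theorem IsSpider.exists_adj_ne (hG : IsSpider G v) (w : W) : ∃ w', G.Adj v w' ∧ w' ≠ w := by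
  by_contra! h
  have h1 : (G.neighborSet v).ncard ≤ ({w} : Set W).ncard :=
    Set.ncard_le_ncard (fun x hx => h x hx) (Set.toFinite _)
  rw [Set.ncard_singleton] at h1
  have := hG.2.1
  omega

end Spider

/-- Lemma 5 of the paper. If `|I_L| = |J_L|` for every leg `L`
of the spider `G`, then there is a TS-sequence between `I` and `J` of length
exactly `M*(G,I,J)`; in particular `D*(G,I,J) = 0`. -/
theorem spider_balanced_legs_no_detours
    {V : Type*} [Fintype V] [DecidableEq V] (G : SimpleGraph V) (v : V)
    (hG : IsSpider G v) (I J : Finset V)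
    (hI : IsIndep G I) (hJ : IsIndep G J) (hcard : I.card = J.card)
    (hreconf : Reconf G I J)
    (hIrigid : ∀ u ∈ I, ¬ RigidToken G I u)
    (hJrigid : ∀ u ∈ J, ¬ RigidToken G J u)
    (w₁ : V) (hw₁ : IsFirstLeg G I J v w₁)
    (hleg : ∀ w, G.Adj v w → ILegCard G I v w₁ w = ILegCard G J v w₁ w) :
    (∃ S, IsTSSeq G I J S ∧ len S = Mstar G I J) ∧ Dstar G I J = 0 := by
  obtain ⟨n, hn⟩ := Int.eq_ofNat_of_zero_le
    (Finset.sum_nonneg fun z (_ : z ∈ Finset.univ) => abs_nonneg (surplus G v I J z))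
  refine HasTSSeq.shortest_no_detours (v := v) (n := n) hG.1 ?_ hn
  have hs : ∀ w, G.Adj v w → surplus G v I J w =
      if w = w₁ then (if v ∈ J then 1 else 0) - (if v ∈ I then 1 else 0) else 0 := by
    intro w hw
    have h : (ILegCard G I v w₁ w : ℤ) = ILegCard G J v w₁ w := by rw [hleg w hw]
    rw [ILegCard_eq_descCount hG.1 w₁ hw, ILegCard_eq_descCount hG.1 w₁ hw] at h
    rw [surplus]
    split_ifs at h ⊢ <;> linarith
  by_cases hvI : v ∈ I <;> by_cases hvJ : v ∈ J <;> simp only [hvI, hvJ, if_true, if_false] at hs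
  · exact hasTSSeq_of_balanced hG n I J hI hJ hcard (by simpa using hs) hn
  · exact hasTSSeq_of_body_token hG hw₁.1 n I J hI hJ hcard hvI (by simpa using hs) hn
  · obtain ⟨w, hw, hne⟩ := hG.exists_adj_ne w₁
    have h := hw₁.2 w hw
    rw [legDiff_eq_surplus hG.1 hw, legDiff_eq_surplus hG.1 hw₁.1, hs w hw, hs w₁ hw₁.1,
      if_neg hne, if_pos rfl] at h
    norm_num at h
  · exact hasTSSeq_of_balanced hG n I J hI hJ hcard (by simpa using hs) hn

end SlidingTokenPaper
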